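/- Let f : D ⊆ E → F be an analytic map between real Banach spaces, let ζ ∈ D be a nondegenerate zero of f (f(ζ) = 0 and Df(ζ) invertible), and let x ∈ D be another zero of f with x ≠ ζ, such that the closed ball of center ζ and radius ‖x − ζ‖ is contained in D. Then γ(f,ζ)·‖x − ζ‖ ≥ 1/2. In particular, two distinct nondegenerate zeros of f cannot lie at distance less than 1/(2γ(f,ζ)) from each other. -/

import Mathlib

open Filter Metric

/-- The k-th term whose supremum over `k ≥ 2` defines Smale's gamma invariant:
`‖(1/k!) · Df(x)⁻¹ ∘ D^k f(x)‖^(1/(k-1))`, where `dinv` plays the role of `Df(x)⁻¹`. -/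
noncomputable def gammaTerm {E F : Type*} [NormedAddCommGroup E] [NormedSpace ℝ E]
    [NormedAddCommGroup F] [NormedSpace ℝ F]
    (f : E → F) (dinv : F →L[ℝ] E) (x : E) (k : ℕ) : ℝ :=
  (‖dinv.compContinuousMultilinearMap (iteratedFDeriv ℝ k f x)‖ / (Nat.factorial k : ℝ)) ^
    ((1 : ℝ) / ((k : ℝ) - 1))

/-- The set of values `gammaTerm f dinv x k` for `k ≥ 2`. -/
noncomputable def gammaSet {E F : Type*} [NormedAddCommGroup E] [NormedSpace ℝ E]
    [NormedAddCommGroup F] [NormedSpace ℝ F]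
    (f : E → F) (dinv : F →L[ℝ] E) (x : E) : Set ℝ :=
  {g : ℝ | ∃ k : ℕ, 2 ≤ k ∧ g = gammaTerm f dinv x k}

/-- Smale's gamma invariant `γ(f,x) = sup_{k ≥ 2} ‖(1/k!)·Df(x)⁻¹ ∘ D^k f(x)‖^(1/(k-1))`. -/
noncomputable def smaleGamma {E F : Type*} [NormedAddCommGroup E] [NormedSpace ℝ E]
    [NormedAddCommGroup F] [NormedSpace ℝ F]
    (f : E → F) (dinv : F →L[ℝ] E) (x : E) : ℝ :=
  sSup (gammaSet f dinv x)

theorem gamma_rpow_le {b G : ℝ} {k : ℕ} (hk : 2 ≤ k) (hb : 0 ≤ b) (hG : 0 ≤ G)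
    (h : b ≤ G ^ (k - 1)) : b ^ ((1 : ℝ) / ((k : ℝ) - 1)) ≤ G := by
  have hk1 : ((k : ℝ) - 1) = ((k - 1 : ℕ) : ℝ) := by
    rw [Nat.cast_sub (by omega)]; simp
  rw [hk1, one_div]
  calc b ^ (((k - 1 : ℕ) : ℝ)⁻¹) ≤ (G ^ (k - 1)) ^ (((k - 1 : ℕ) : ℝ)⁻¹) :=
        Real.rpow_le_rpow hb h (by positivity)
    _ = G := Real.pow_rpow_inv_natCast hG (by omega)

theorem gamma_le_pow {b G : ℝ} {k : ℕ} (hk : 2 ≤ k) (hb : 0 ≤ b)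
    (h : b ^ ((1 : ℝ) / ((k : ℝ) - 1)) ≤ G) : b ≤ G ^ (k - 1) := by
  have hk1 : ((k : ℝ) - 1) = ((k - 1 : ℕ) : ℝ) := by
    rw [Nat.cast_sub (by omega)]; simp
  rw [hk1, one_div] at h
  calc b = (b ^ (((k - 1 : ℕ) : ℝ)⁻¹)) ^ (k - 1) :=
        (Real.rpow_inv_natCast_pow hb (by omega)).symm
    _ ≤ G ^ (k - 1) := pow_le_pow_left₀ (by positivity) h _

theorem gammaSet_bddAbove {E F : Type*} [NormedAddCommGroup E] [NormedSpace ℝ E]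
    [NormedAddCommGroup F] [NormedSpace ℝ F] [CompleteSpace F]
    {f : E → F} (dinv : F →L[ℝ] E) {ζ : E} (hf : AnalyticAt ℝ f ζ) :
    BddAbove (gammaSet f dinv ζ) := by
  obtain ⟨p, ρ, hp⟩ := hf
  obtain ⟨C, r, hC, hr, hpb⟩ := p.le_mul_pow_of_radius_pos (hp.r_pos.trans_le hp.r_le)
  set B := max 1 (‖dinv‖ * C) with hB
  set R := max 1 r with hR
  have hB1 : 1 ≤ B := le_max_left _ _
  have hR1 : 1 ≤ R := le_max_left _ _
  refine ⟨B * R ^ 2, ?_⟩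
  rintro g ⟨k, hk, rfl⟩
  unfold gammaTerm
  refine gamma_rpow_le hk (by positivity) (by positivity) ?_
  have hfac : (0 : ℝ) < (Nat.factorial k : ℝ) := by positivity
  rw [div_le_iff₀ hfac]
  have h1 : ‖iteratedFDeriv ℝ k f ζ‖ ≤ (Nat.factorial k : ℝ) * ‖p k‖ := by
    refine ContinuousMultilinearMap.opNorm_le_bound (by positivity) fun v => ?_
    rw [hp.iteratedFDeriv_eq_sum_of_completeSpace]
    calc ‖∑ σ : Equiv.Perm (Fin k), p k (fun i ↦ v (σ i))‖
        ≤ ∑ σ : Equiv.Perm (Fin k), ‖p k‖ * ∏ i, ‖v i‖ := by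
          refine norm_sum_le_of_le _ fun σ _ => ?_
          refine ((p k).le_opNorm _).trans_eq ?_
          rw [Equiv.prod_comp σ (fun i => ‖v i‖)]
      _ = _ := by
          simp [Fintype.card_perm]; ring
  calc ‖dinv.compContinuousMultilinearMap (iteratedFDeriv ℝ k f ζ)‖
      ≤ ‖dinv‖ * ‖iteratedFDeriv ℝ k f ζ‖ :=
        ContinuousLinearMap.norm_compContinuousMultilinearMap_le _ _
    _ ≤ ‖dinv‖ * ((Nat.factorial k : ℝ) * (C * r ^ k)) := by
        gcongr
        exact h1.trans (by gcongr; exact hpb k)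
    _ = (‖dinv‖ * C) * r ^ k * (Nat.factorial k : ℝ) := by ring
    _ ≤ (B * R ^ 2) ^ (k - 1) * (Nat.factorial k : ℝ) := by
        gcongr
        rw [mul_pow, ← pow_mul]
        have e1 : ‖dinv‖ * C ≤ B ^ (k - 1) :=
          (le_max_right _ _).trans (le_self_pow₀ hB1 (by omega))
        have e2 : r ^ k ≤ R ^ (2 * (k - 1)) :=
          (pow_le_pow_left₀ hr.le (le_max_right _ _) k).trans
            (pow_le_pow_right₀ hR1 (by omega))
        gcongr

/-- separation of zeros: if `ζ` is a nondegenerate zero of the analytic map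
`f` and `x ≠ ζ` is another zero of `f`, with the closed ball of center `ζ` and radius
`‖x - ζ‖` contained in `D`, then `γ(f,ζ)·‖x - ζ‖ ≥ 1/2`. -/
theorem stmt13 {E F : Type*} [NormedAddCommGroup E] [NormedSpace ℝ E] [CompleteSpace E]
    [NormedAddCommGroup F] [NormedSpace ℝ F] [CompleteSpace F]
    (D : Set E) (hD : IsOpen D) (f : E → F) (hf : AnalyticOnNhd ℝ f D)
    (ζ : E) (hζ : ζ ∈ D) (hfζ : f ζ = 0)
    (A : E ≃L[ℝ] F) (hA : (A : E →L[ℝ] F) = fderiv ℝ f ζ)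
    (x : E) (hx : x ∈ D) (hfx : f x = 0) (hne : x ≠ ζ)
    (hball : Metric.closedBall ζ ‖x - ζ‖ ⊆ D) :
    (1 : ℝ) / 2 ≤ smaleGamma f (A.symm : F →L[ℝ] E) ζ * ‖x - ζ‖ := by
  by_contra! hlt
  set u := ‖x - ζ‖ with hu
  set γ := smaleGamma f (A.symm : F →L[ℝ] E) ζ with hγ
  set v := x - ζ with hv
  have hu0 : 0 < u := norm_pos_iff.2 (sub_ne_zero.2 hne)
  have hbdd := gammaSet_bddAbove (A.symm : F →L[ℝ] E) (hf ζ hζ)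
  have hterm : ∀ k, 2 ≤ k → gammaTerm f (A.symm : F →L[ℝ] E) ζ k ≤ γ :=
    fun k hk => le_csSup hbdd ⟨k, hk, rfl⟩
  have hγ0 : 0 ≤ γ := by
    refine le_trans ?_ (hterm 2 le_rfl)
    unfold gammaTerm; positivity
  obtain ⟨p, ρ, hp⟩ := hf ζ hζ
  set c : ℕ → E := fun k => A.symm (p k fun _ => v) with hc
  have hc0 : c 0 = 0 := by
    have : p 0 (fun _ => v) = f ζ := hp.coeff_zero _
    simp [hc, this, hfζ]
  have hc1 : c 1 = v := by
    have h1 := hp.hasFPowerSeriesAt.fderiv_eq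
    have h2 : p 1 (fun _ => v) = A v := by
      have : (A : E →L[ℝ] F) v = (continuousMultilinearCurryFin1 ℝ E F (p 1)) v := by
        rw [hA, h1]
      rw [← ContinuousLinearEquiv.coe_coe, this, continuousMultilinearCurryFin1_apply]
      congr 1
    simp [hc, h2]
  have hcb : ∀ k, ‖c (k + 1)‖ ≤ u * (γ * u) ^ k := by
    intro k
    rcases Nat.eq_zero_or_pos k with rfl | hk
    · simp [hc1, hu]
    · have h1 := gamma_le_pow (by omega) (by positivity) (hterm (k + 1) (by omega))
      have hfac : (0 : ℝ) < (Nat.factorial (k + 1) : ℝ) := by positivity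
      rw [div_le_iff₀ hfac, Nat.add_sub_cancel] at h1
      have h2 := ((A.symm : F →L[ℝ] E).compContinuousMultilinearMap
        (iteratedFDeriv ℝ (k + 1) f ζ)).le_opNorm (fun _ => v)
      have h3 : ((A.symm : F →L[ℝ] E).compContinuousMultilinearMap
        (iteratedFDeriv ℝ (k + 1) f ζ)) (fun _ => v) = (Nat.factorial (k + 1) : ℝ) • c (k + 1) := by
        rw [ContinuousLinearMap.compContinuousMultilinearMap_coe, Function.comp_apply,
          ← hp.factorial_smul v (k + 1), ← Nat.cast_smul_eq_nsmul ℝ, map_smul]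
        rfl
      rw [h3, norm_smul, Real.norm_of_nonneg hfac.le] at h2
      simp only [Finset.prod_const, Finset.card_univ, Fintype.card_fin] at h2
      have h4 : (Nat.factorial (k + 1) : ℝ) * ‖c (k + 1)‖
          ≤ (Nat.factorial (k + 1) : ℝ) * (u * (γ * u) ^ k) := by
        calc _ ≤ _ := h2
          _ ≤ (γ ^ k * (Nat.factorial (k + 1) : ℝ)) * u ^ (k + 1) := by gcongr
          _ = _ := by ring
      exact le_of_mul_le_mul_left h4 hfac
  have hγu0 : 0 ≤ γ * u := by positivity
  set q : FormalMultilinearSeries ℝ ℝ E :=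
    fun k => ContinuousMultilinearMap.mkPiRing ℝ (Fin k) (c k) with hq
  have hqapp : ∀ (t : ℝ) k, q k (fun _ => t) = t ^ k • c k := by
    intro t k
    simp [hq]
  have hrad : ((2 : NNReal) : ENNReal) ≤ q.radius := by
    refine q.le_radius_of_bound (2 * u) fun k => ?_
    have : ‖q k‖ = ‖c k‖ := by simp [hq]
    rw [this]
    rcases k with _ | k
    · simp [hc0]; positivity
    · calc ‖c (k + 1)‖ * ((2 : NNReal) : ℝ) ^ (k + 1)
          ≤ (u * (γ * u) ^ k) * 2 ^ (k + 1) := by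
            gcongr
            · exact hcb k
            · simp
        _ = (2 * u) * (2 * (γ * u)) ^ k := by rw [mul_pow 2 (γ * u)]; ring
        _ ≤ 2 * u := by
            apply mul_le_of_le_one_right (by positivity)
            exact pow_le_one₀ (by positivity) (by linarith)
  have hqs := q.hasFPowerSeriesOnBall (lt_of_lt_of_le (by norm_num) hrad)
  have hmem : ∀ t ∈ Set.Icc (0 : ℝ) 1, t ∈ Metric.eball (0 : ℝ) q.radius := by
    intro t ht
    refine Metric.eball_subset_eball hrad ?_
    rw [← ENNReal.ofReal_coe_nnreal, Metric.eball_ofReal]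
    simp only [Metric.mem_ball, dist_zero_right, Real.norm_eq_abs, abs_of_nonneg ht.1]
    have := ht.2
    norm_num
    linarith
  set g : ℝ → E := fun t => A.symm (f (ζ + t • v)) with hg
  have hgan : AnalyticOnNhd ℝ g (Set.Icc 0 1) := by
    intro t ht
    have hin : ζ + t • v ∈ D := by
      apply hball
      simp only [Metric.mem_closedBall, dist_self_add_left, norm_smul, Real.norm_eq_abs,
        abs_of_nonneg ht.1]
      exact mul_le_of_le_one_left hu0.le ht.2
    have h1 : AnalyticAt ℝ (fun t : ℝ => ζ + t • v) t := by fun_prop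
    have h2 : AnalyticAt ℝ (fun t : ℝ => f (ζ + t • v)) t :=
      AnalyticAt.fun_comp (hf _ hin) h1
    exact ((A.symm : F →L[ℝ] E).analyticAt _).fun_comp h2
  have hhan : AnalyticOnNhd ℝ q.sum (Set.Icc 0 1) :=
    fun t ht => hqs.analyticAt_of_mem (hmem t ht)
  have hev : g =ᶠ[nhds 0] q.sum := by
    have hcont : Filter.Tendsto (fun t : ℝ => t • v) (nhds 0) (nhds 0) := by
      have : Continuous (fun t : ℝ => t • v) := by fun_prop
      simpa using this.tendsto 0
    filter_upwards [hcont.eventually (Metric.eball_mem_nhds (0 : E) hp.r_pos)] with t ht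
    have h1 := (hp.hasSum ht).mapL (A.symm : F →L[ℝ] E)
    have h2 : HasSum (fun k => q k (fun _ => t)) (g t) := by
      change HasSum _ ((A.symm : F →L[ℝ] E) (f (ζ + t • v)))
      convert h1 using 1
      funext k
      rw [hqapp]
      have : p k (fun _ => t • v) = t ^ k • p k (fun _ => v) := by
        simpa using (p k).map_smul_univ (fun _ => t) (fun _ => v)
      simp [hc, this]
    exact h2.tsum_eq.symm
  have heq := hgan.eqOn_of_preconnected_of_eventuallyEq hhan isPreconnected_Icc
    (Set.left_mem_Icc.2 zero_le_one) hev (Set.right_mem_Icc.2 zero_le_one)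
  have hg1 : g 1 = 0 := by simp [hg, hv, hfx]
  have hs := hqs.hasSum (hmem 1 (Set.right_mem_Icc.2 zero_le_one))
  rw [zero_add, ← heq, hg1] at hs
  simp only [hqapp, one_pow, one_smul] at hs
  have hs2 : HasSum (fun k => c (k + 2)) (-v) := by
    rw [hasSum_nat_add_iff]
    simpa [Finset.sum_range_succ, hc0, hc1] using hs
  have hgeo : HasSum (fun k => u * (γ * u) * (γ * u) ^ k) (u * (γ * u) * (1 - γ * u)⁻¹) :=
    (hasSum_geometric_of_lt_one hγu0 (by linarith)).mul_left _
  have hle := hs2.norm_le_of_bounded hgeo fun k => (hcb (k + 1)).trans_eq (by ring)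
  rw [norm_neg, ← div_eq_mul_inv, le_div_iff₀ (by linarith)] at hle
  change u * _ ≤ _ at hle
  nlinarith
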